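/- Fix ε > 0. Let P₁ and P₂ be finite sets of points in ℝ² with |P₁| = ⌈m^{1/2+ε}⌉ and |P₂| = m (where 0 < ε ≤ 1/2), such that all points of P₁ lie on a line ℓ₁, all points of P₂ lie on a line ℓ₂, and ℓ₁ and ℓ₂ are neither parallel nor orthogonal. Then D(P₁,P₂) = Ω(m^{1+2ε/3}); that is, there is a constant c > 0 (depending only on ε) such that D(P₁,P₂) ≥ c · m^{1+2ε/3}. -/

import Mathlib

open scoped Classical RealInnerProductSpace

/-- The squared distance between two points at signed distances `p.1` and `p.2` from the
intersection of two lines whose angle has cosine `l`. -/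
def cosineForm (l : ℝ) (p : ℝ × ℝ) : ℝ := p.1 ^ 2 + p.2 ^ 2 - 2 * l * p.1 * p.2

theorem card_le_card_add_card_offDiag {α κ : Type*} [DecidableEq α] [DecidableEq κ]
    (S : Finset α) (K : Finset κ) (f : α → κ) (hf : ∀ x ∈ S, f x ∈ K) :
    S.card ≤ K.card + (S.offDiag.filter (fun e => f e.1 = f e.2)).card := by
  obtain ⟨R, hRS, hR⟩ : ∃ R ⊆ S, R.image f = S.image f ∧ Set.InjOn f R := by
    obtain ⟨u, hu, himg⟩ := Set.exists_subset_bijOn (S : Set α) f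
    lift u to Finset α using S.finite_toSet.subset hu
    refine ⟨u, mod_cast hu, ?_, himg.injOn⟩
    exact_mod_cast himg.image_eq
  have hex : ∀ x ∈ S, ∃ y ∈ R, f y = f x := fun x hx => by
    have : f x ∈ R.image f := hR.1 ▸ Finset.mem_image_of_mem f hx
    simpa using this
  choose! r hrR hr using hex
  have h2 : R.card ≤ K.card :=
    Finset.card_le_card_of_injOn f (fun x hx => hf x (hRS hx)) hR.2
  have h3 : (S \ R).card ≤ (S.offDiag.filter (fun e => f e.1 = f e.2)).card := by
    refine Finset.card_le_card_of_injOn (fun x => (x, r x)) ?_ ?_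
    · intro x hx
      have hx' := Finset.mem_sdiff.1 hx
      simp only [Finset.coe_filter, Finset.mem_offDiag, Set.mem_ofPred_eq]
      refine ⟨⟨hx'.1, hRS (hrR x hx'.1), ?_⟩, (hr x hx'.1).symm⟩
      intro h
      exact hx'.2 (h ▸ hrR x hx'.1)
    · intro x _ y _ h
      exact (Prod.mk.inj h).1
  have h4 := Finset.card_sdiff_add_card_eq_card hRS
  omega

theorem card_sq_le_card_image_mul_card_fiber_pairs {α κ : Type*} [DecidableEq α] [DecidableEq κ]
    (G : Finset α) (f : α → κ) :
    G.card ^ 2 ≤ (G.image f).card * ((G ×ˢ G).filter (fun e => f e.1 = f e.2)).card := by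
  have h1 : G.card = ∑ d ∈ G.image f, (G.filter (fun p => f p = d)).card :=
    Finset.card_eq_sum_card_image f G
  have h2 : ((G ×ˢ G).filter (fun e => f e.1 = f e.2)).card
      = ∑ d ∈ G.image f, (G.filter (fun p => f p = d)).card ^ 2 := by
    rw [Finset.card_eq_sum_card_fiberwise (f := fun e => f e.1) (t := G.image f)]
    · refine Finset.sum_congr rfl fun d _ => ?_
      rw [sq, ← Finset.card_product]
      congr 1
      ext ⟨p, q⟩
      simp only [Finset.mem_filter, Finset.mem_product]
      constructor
      · rintro ⟨⟨⟨hp, hq⟩, h⟩, hd⟩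
        exact ⟨⟨hp, hd⟩, hq, h ▸ hd⟩
      · rintro ⟨⟨hp, hd⟩, hq, hd'⟩
        exact ⟨⟨⟨hp, hq⟩, hd.trans hd'.symm⟩, hd⟩
    · intro e he
      have he' := Finset.mem_filter.1 he
      exact Finset.mem_coe.2 (Finset.mem_image_of_mem f (Finset.mem_product.1 he'.1).1)
  rw [h2, h1]
  exact sq_sum_le_card_mul_sum_sq

/-- A nonconstant polynomial of degree at most two has at most two roots. -/
theorem quadratic_coeffs_eq_zero_of_three_roots {α β γ p q r : ℝ} (hpq : p ≠ q) (hpr : p ≠ r)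
    (hqr : q ≠ r) (hp : α * p ^ 2 + β * p + γ = 0) (hq : α * q ^ 2 + β * q + γ = 0)
    (hr : α * r ^ 2 + β * r + γ = 0) : α = 0 ∧ β = 0 := by
  have h1 : α * (p + q) + β = 0 := by
    apply mul_left_cancel₀ (sub_ne_zero.2 hpq)
    linear_combination hp - hq
  have h2 : α * (p + r) + β = 0 := by
    apply mul_left_cancel₀ (sub_ne_zero.2 hpr)
    linear_combination hp - hr
  have h3 : α = 0 := by
    apply mul_left_cancel₀ (sub_ne_zero.2 hqr)
    linear_combination h1 - h2
  exact ⟨h3, by rw [h3] at h1; linarith⟩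

/-- Two points off the diagonal, in increasing position, lie on at most two of the curves
`cosineForm l (x, b) = cosineForm l (y, b')`. -/
theorem card_curves_through_two_points_le {l : ℝ} (hl : l ≠ 0) (hl1 : l ^ 2 ≠ 1)
    {a₁ a₂ c₁ c₂ : ℝ} (hpos : 0 < (a₂ - a₁) * (c₂ - c₁)) (hne : a₁ ≠ c₁)
    (S : Finset (ℝ × ℝ))
    (h₁ : ∀ b ∈ S, cosineForm l (a₁, b.1) = cosineForm l (c₁, b.2))
    (h₂ : ∀ b ∈ S, cosineForm l (a₂, b.1) = cosineForm l (c₂, b.2)) : S.card ≤ 2 := by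
  by_contra! hS
  obtain ⟨u, hu, v, hv, w, hw, huv, huw, hvw⟩ := Finset.two_lt_card.1 hS
  simp only [cosineForm] at h₁ h₂
  set h := a₂ - a₁ with hh
  set k := c₂ - c₁ with hk
  have hh0 : h ≠ 0 := by rintro h0; simp [h0] at hpos
  have hk0 : k ≠ 0 := by rintro h0; simp [h0] at hpos
  have ha : a₂ = a₁ + h := by rw [hh]; ring
  have hc : c₂ = c₁ + k := by rw [hk]; ring
  rw [ha, hc] at h₂
  clear_value h k
  have hlin : ∀ b ∈ S, h * (2 * a₁ + h) - 2 * l * h * b.1 = k * (2 * c₁ + k) - 2 * l * k * b.2 := by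
    intro b hb
    linear_combination h₂ b hb - h₁ b hb
  have hfst : ∀ b ∈ S, b.1 = u.1 + k * ((b.2 - u.2) / h) := by
    intro b hb
    field_simp
    apply mul_left_cancel₀ (mul_ne_zero two_ne_zero hl)
    linear_combination hlin u hu - hlin b hb
  have hinj : ∀ b ∈ S, ∀ b' ∈ S, b ≠ b' → (b.2 - u.2) / h ≠ (b'.2 - u.2) / h := by
    intro b hb b' hb' hbb heq
    apply hbb
    have e1 : b.2 = b'.2 := by
      field_simp at heq
      linarith
    refine Prod.ext ?_ e1
    rw [hfst b hb, hfst b' hb', heq]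
  have hquad : ∀ b ∈ S, (k ^ 2 - h ^ 2) * ((b.2 - u.2) / h) ^ 2
      + (2 * k * u.1 - 2 * l * a₁ * k - 2 * h * u.2 + 2 * l * c₁ * h) * ((b.2 - u.2) / h)
      + 0 = 0 := by
    intro b hb
    have e1 := hfst b hb
    have e2 : b.2 = u.2 + h * ((b.2 - u.2) / h) := by field_simp; ring
    have e3 := h₁ b hb
    have e4 := h₁ u hu
    generalize (b.2 - u.2) / h = t at *
    rw [e1, e2] at e3
    linear_combination e3 - e4
  obtain ⟨q1, q2⟩ := quadratic_coeffs_eq_zero_of_three_roots (hinj u hu v hv huv)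
    (hinj u hu w hw huw) (hinj v hv w hw hvw) (hquad u hu) (hquad v hv) (hquad w hw)
  have hkh : k = h := by
    have hfac : (k - h) * (k + h) = 0 := by linear_combination q1
    rcases mul_eq_zero.1 hfac with h0 | h0
    · linarith
    · have : k = -h := by linarith
      rw [this] at hpos
      nlinarith [sq_nonneg h]
  subst hkh
  have e1 : u.1 - u.2 = l * (a₁ - c₁) := by
    apply mul_left_cancel₀ (mul_ne_zero two_ne_zero hk0)
    linear_combination q2
  have e2 : l * (u.1 - u.2) = a₁ - c₁ := by
    apply mul_left_cancel₀ (mul_ne_zero two_ne_zero hk0)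
    linear_combination -(hlin u hu)
  rw [e1] at e2
  apply hl1
  apply mul_right_cancel₀ (sub_ne_zero.2 hne)
  linear_combination e2

/-- On one side of its minimum, a level-set correspondence of `cosineForm` is increasing. -/
theorem cosineForm_increasing_position {l σ a₁ a₂ b c₁ c₂ b' : ℝ} (hσ : σ ≠ 0)
    (ha₁ : 0 ≤ σ * (a₁ - l * b)) (ha₂ : 0 ≤ σ * (a₂ - l * b))
    (hc₁ : 0 ≤ σ * (c₁ - l * b')) (hc₂ : 0 ≤ σ * (c₂ - l * b'))
    (h₁ : cosineForm l (a₁, b) = cosineForm l (c₁, b'))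
    (h₂ : cosineForm l (a₂, b) = cosineForm l (c₂, b')) :
    a₁ < a₂ → c₁ < c₂ := by
  intro hlt
  simp only [cosineForm] at h₁ h₂
  have key : (a₂ - a₁) * (σ * (a₁ - l * b) + σ * (a₂ - l * b))
      = (c₂ - c₁) * (σ * (c₁ - l * b') + σ * (c₂ - l * b')) := by
    linear_combination σ * (h₂ - h₁)
  have hne : σ * (a₁ - l * b) + σ * (a₂ - l * b) ≠ 0 := by
    intro h0
    have e1 : σ * (a₁ - l * b) = 0 := by linarith
    have e2 : σ * (a₂ - l * b) = 0 := by linarith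
    have : σ * (a₂ - a₁) = 0 := by linear_combination e2 - e1
    rcases mul_eq_zero.1 this with h | h
    · exact hσ h
    · linarith
  have hpos : 0 < (a₂ - a₁) * (σ * (a₁ - l * b) + σ * (a₂ - l * b)) :=
    mul_pos (by linarith) (lt_of_le_of_ne (by linarith) hne.symm)
  by_contra! hle
  rw [key] at hpos
  nlinarith [mul_nonneg (sub_nonneg.2 hle) (add_nonneg hc₁ hc₂)]

/-- The index of the block of `s` consecutive elements of `A` containing `a`. -/
noncomputable def blockIndex (A : Finset ℝ) (s : ℕ) (a : ℝ) : ℕ := (A.filter (· < a)).card / s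

theorem blockIndex_mono (A : Finset ℝ) (s : ℕ) : Monotone (blockIndex A s) := fun _ _ h =>
  Nat.div_le_div_right (Finset.card_le_card
    (Finset.monotone_filter_right A fun _ _ hx => lt_of_lt_of_le hx h))

theorem blockIndex_le (A : Finset ℝ) (s : ℕ) (a : ℝ) : blockIndex A s a ≤ A.card / s :=
  Nat.div_le_div_right (Finset.card_filter_le _ _)

theorem card_same_block_le (A : Finset ℝ) {s : ℕ} (hs : 0 < s) :
    ((A ×ˢ A).filter (fun p => blockIndex A s p.1 = blockIndex A s p.2)).card ≤ A.card * s := by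
  have hinj : Set.InjOn (fun a => (A.filter (· < a)).card) (A : Set ℝ) := by
    have hmono : ∀ a ∈ A, ∀ b ∈ A, a < b →
        (A.filter (· < a)).card < (A.filter (· < b)).card := by
      intro a ha b _ hab
      refine Finset.card_lt_card ((Finset.ssubset_iff_of_subset
        (Finset.monotone_filter_right A fun _ _ hx => lt_trans hx hab)).2 ⟨a, ?_, ?_⟩)
      · simp [ha, hab]
      · simp
    intro a ha b hb hab
    rcases lt_trichotomy a b with h | h | h
    · exact absurd hab (hmono a ha b hb h).ne
    · exact h
    · exact absurd hab (hmono b hb a ha h).ne'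
  have hsub : ((A ×ˢ A).filter (fun p => blockIndex A s p.1 = blockIndex A s p.2)).card
      ≤ (A ×ˢ Finset.range s).card := by
    refine Finset.card_le_card_of_injOn
      (fun p => (p.1, (A.filter (· < p.2)).card % s)) ?_ ?_
    · intro p hp
      have hp' := Finset.mem_product.1 (Finset.mem_filter.1 hp).1
      simp [hp'.1, Nat.mod_lt _ hs]
    · intro p hp q hq hpq
      have hp' := Finset.mem_filter.1 hp
      have hq' := Finset.mem_filter.1 hq
      obtain ⟨e1, e2⟩ := Prod.mk.inj hpq
      refine Prod.ext e1 (hinj (Finset.mem_product.1 hp'.1).2 (Finset.mem_product.1 hq'.1).2 ?_)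
      have e3 : (A.filter (· < p.2)).card / s = (A.filter (· < q.2)).card / s :=
        hp'.2.symm.trans ((congrArg _ e1).trans hq'.2)
      have e4 := Nat.div_add_mod (A.filter (· < p.2)).card s
      have e5 := Nat.div_add_mod (A.filter (· < q.2)).card s
      rw [e3, e2] at e4
      exact e4.symm.trans e5
  simpa using hsub

/-- An energy bound for `cosineForm` on one side of its minimum. -/
theorem energy_cosineForm_le {l σ : ℝ} (hl : l ≠ 0) (hl1 : l ^ 2 ≠ 1) (hσ : σ ≠ 0)
    (A B : Finset ℝ) (G : Finset (ℝ × ℝ)) (hGAB : G ⊆ A ×ˢ B)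
    (hG : ∀ p ∈ G, 0 ≤ σ * (p.1 - l * p.2)) {s : ℕ} (hs : 0 < s) :
    ((G ×ˢ G).filter (fun e => cosineForm l e.1 = cosineForm l e.2)).card
      ≤ 2 * (A.card * B.card) + B.card ^ 2 * (2 * (A.card / s) + 1)
        + 2 * (A.card * s) ^ 2 := by
  have hmem : ∀ p ∈ G, p.1 ∈ A ∧ p.2 ∈ B := fun p hp => Finset.mem_product.1 (hGAB hp)
  set N := (G ×ˢ G).filter (fun e => cosineForm l e.1 = cosineForm l e.2) with hN
  have hNmem : ∀ e ∈ N, e.1 ∈ G ∧ e.2 ∈ G ∧ cosineForm l e.1 = cosineForm l e.2 := by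
    intro e he
    have := Finset.mem_filter.1 he
    exact ⟨(Finset.mem_product.1 this.1).1, (Finset.mem_product.1 this.1).2, this.2⟩
  have hdiag : (N.filter (fun e => e.1.1 = e.2.1)).card ≤ 2 * (A.card * B.card) := by
    rw [← Finset.card_product]
    refine Finset.card_le_mul_card_image_of_maps_to (f := fun e => e.1) ?_ 2 ?_
    · intro e he
      exact hGAB (hNmem e (Finset.mem_filter.1 he).1).1
    · intro p _
      by_contra! h3
      obtain ⟨u, hu, v, hv, w, hw, huv, huw, hvw⟩ := Finset.two_lt_card.1 h3
      have hroot : ∀ e ∈ (N.filter (fun e => e.1.1 = e.2.1)).filter (fun e => e.1 = p),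
          1 * e.2.2 ^ 2 + (-2 * l * p.1) * e.2.2 + (p.1 ^ 2 - cosineForm l p) = 0
            ∧ e = (p, (p.1, e.2.2)) := by
        intro e he
        obtain ⟨he1, rfl⟩ := Finset.mem_filter.1 he
        obtain ⟨he2, he3⟩ := Finset.mem_filter.1 he1
        have he4 := (hNmem e he2).2.2
        constructor
        · rw [he4]
          simp only [cosineForm]
          rw [he3]
          ring
        · rw [he3]
      have hneq : ∀ e ∈ (N.filter (fun e => e.1.1 = e.2.1)).filter (fun e => e.1 = p),
          ∀ e' ∈ (N.filter (fun e => e.1.1 = e.2.1)).filter (fun e => e.1 = p),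
          e ≠ e' → e.2.2 ≠ e'.2.2 := by
        intro e he e' he' hee h
        apply hee
        rw [(hroot e he).2, (hroot e' he').2, h]
      exact one_ne_zero (quadratic_coeffs_eq_zero_of_three_roots (hneq u hu v hv huv)
        (hneq u hu w hw huw) (hneq v hv w hw hvw) (hroot u hu).1 (hroot v hv).1 (hroot w hw).1).1
  set E := N.filter (fun e => ¬ e.1.1 = e.2.1) with hE
  have hEmem : ∀ e ∈ E, e.1 ∈ G ∧ e.2 ∈ G ∧ cosineForm l e.1 = cosineForm l e.2
      ∧ e.1.1 ≠ e.2.1 := by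
    intro e he
    obtain ⟨h1, h2⟩ := Finset.mem_filter.1 he
    obtain ⟨h3, h4, h5⟩ := hNmem e h1
    exact ⟨h3, h4, h5, h2⟩
  have hchain : ∀ e ∈ E, ∀ e' ∈ E, e.1.2 = e'.1.2 → e.2.2 = e'.2.2 →
      (e.1.1 < e'.1.1 ↔ e.2.1 < e'.2.1) := by
    rintro ⟨⟨a₁, b⟩, c₁, d⟩ he ⟨⟨a₂, _⟩, c₂, _⟩ he' ⟨⟩ ⟨⟩
    obtain ⟨g1, g2, g3, -⟩ := hEmem _ he
    obtain ⟨g1', g2', g3', -⟩ := hEmem _ he'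
    exact ⟨cosineForm_increasing_position hσ (hG _ g1) (hG _ g1') (hG _ g2) (hG _ g2') g3 g3',
      cosineForm_increasing_position hσ (hG _ g2) (hG _ g2') (hG _ g1) (hG _ g1') g3.symm g3'.symm⟩
  set key : (ℝ × ℝ) × (ℝ × ℝ) → (ℝ × ℝ) × ℕ := fun e =>
    ((e.1.2, e.2.2), blockIndex A s e.1.1 + blockIndex A s e.2.1) with hkey
  have hcard := card_le_card_add_card_offDiag E
    ((B ×ˢ B) ×ˢ Finset.range (2 * (A.card / s) + 1)) key (by
      intro e he
      obtain ⟨g1, g2, -⟩ := hEmem e he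
      have i1 := blockIndex_le A s e.1.1
      have i2 := blockIndex_le A s e.2.1
      simp only [hkey, Finset.mem_product, Finset.mem_range]
      exact ⟨⟨(hmem _ g1).2, (hmem _ g2).2⟩, by omega⟩)
  set V := (A ×ˢ A).filter (fun p => blockIndex A s p.1 = blockIndex A s p.2) with hV
  have hVcard : V.card ≤ A.card * s := card_same_block_le A hs
  set T := E.offDiag.filter (fun e => key e.1 = key e.2) with hT
  have hTmem : ∀ t ∈ T, t.1 ∈ E ∧ t.2 ∈ E ∧ t.1.1.2 = t.2.1.2 ∧ t.1.2.2 = t.2.2.2 ∧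
      blockIndex A s t.1.1.1 = blockIndex A s t.2.1.1 ∧
      blockIndex A s t.1.2.1 = blockIndex A s t.2.2.1 ∧
      0 < (t.2.1.1 - t.1.1.1) * (t.2.2.1 - t.1.2.1) := by
    intro t ht
    obtain ⟨h1, h2⟩ := Finset.mem_filter.1 ht
    obtain ⟨h3, h4, h5⟩ := Finset.mem_offDiag.1 h1
    obtain ⟨h6, h7⟩ := Prod.mk.inj h2
    obtain ⟨h8, h9⟩ := Prod.mk.inj h6
    have c1 := hchain _ h3 _ h4 h8 h9
    have c2 := hchain _ h4 _ h3 h8.symm h9.symm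
    rcases lt_trichotomy t.1.1.1 t.2.1.1 with h | h | h
    · have h' := c1.1 h
      have m1 := blockIndex_mono A s h.le
      have m2 := blockIndex_mono A s h'.le
      exact ⟨h3, h4, h8, h9, by omega, by omega, mul_pos (sub_pos.2 h) (sub_pos.2 h')⟩
    · exfalso
      apply h5
      have h' : t.1.2.1 = t.2.2.1 := by
        rcases lt_trichotomy t.1.2.1 t.2.2.1 with h' | h' | h'
        · exact absurd (c1.2 h') h.not_lt
        · exact h'
        · exact absurd (c2.2 h') h.not_gt
      exact Prod.ext (Prod.ext h h8) (Prod.ext h' h9)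
    · have h' := c2.1 h
      have m1 := blockIndex_mono A s h.le
      have m2 := blockIndex_mono A s h'.le
      exact ⟨h3, h4, h8, h9, by omega, by omega,
        mul_pos_of_neg_of_neg (sub_neg.2 h) (sub_neg.2 h')⟩
  have hTcard : T.card ≤ 2 * (V ×ˢ V).card := by
    refine Finset.card_le_mul_card_image_of_maps_to
      (f := fun t => ((t.1.1.1, t.2.1.1), (t.1.2.1, t.2.2.1))) ?_ 2 ?_
    · intro t ht
      obtain ⟨h1, h2, -, -, h5, h6, -⟩ := hTmem t ht
      obtain ⟨g1, g2, -⟩ := hEmem _ h1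
      obtain ⟨g1', g2', -⟩ := hEmem _ h2
      simp only [hV, Finset.mem_product, Finset.mem_filter]
      exact ⟨⟨⟨(hmem _ g1).1, (hmem _ g1').1⟩, h5⟩, ⟨(hmem _ g2).1, (hmem _ g2').1⟩, h6⟩
    · rintro ⟨⟨a₁, a₂⟩, c₁, c₂⟩ -
      set F := T.filter (fun t => ((t.1.1.1, t.2.1.1), (t.1.2.1, t.2.2.1)) = ((a₁, a₂), c₁, c₂))
        with hF
      have hFmem : ∀ t ∈ F, t ∈ T ∧ t.1.1.1 = a₁ ∧ t.2.1.1 = a₂ ∧ t.1.2.1 = c₁ ∧ t.2.2.1 = c₂ := by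
        intro t ht
        obtain ⟨h1, h2⟩ := Finset.mem_filter.1 ht
        simp only [Prod.mk.injEq] at h2
        exact ⟨h1, h2.1.1, h2.1.2, h2.2.1, h2.2.2⟩
      have hFinj : Set.InjOn (fun t : ((ℝ × ℝ) × (ℝ × ℝ)) × ((ℝ × ℝ) × (ℝ × ℝ)) =>
          (t.1.1.2, t.1.2.2)) (F : Set _) := by
        intro t ht t' ht' htt
        obtain ⟨h0, h1, h2, h3, h4⟩ := hFmem t ht
        obtain ⟨h0', h1', h2', h3', h4'⟩ := hFmem t' ht'
        obtain ⟨-, -, k1, k2, -⟩ := hTmem t h0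
        obtain ⟨-, -, k1', k2', -⟩ := hTmem t' h0'
        obtain ⟨j1, j2⟩ := Prod.mk.inj htt
        refine Prod.ext (Prod.ext (Prod.ext ?_ ?_) (Prod.ext ?_ ?_))
          (Prod.ext (Prod.ext ?_ ?_) (Prod.ext ?_ ?_))
        · rw [h1, h1']
        · exact j1
        · rw [h3, h3']
        · exact j2
        · rw [h2, h2']
        · rw [← k1, ← k1', j1]
        · rw [h4, h4']
        · rw [← k2, ← k2', j2]
      rcases F.eq_empty_or_nonempty with h0 | ⟨t₀, ht₀⟩
      · simp [h0]
      rw [← Finset.card_image_of_injOn hFinj]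
      obtain ⟨f0, rfl, rfl, rfl, rfl⟩ := hFmem t₀ ht₀
      obtain ⟨f1, -, -, -, -, -, f2⟩ := hTmem t₀ f0
      refine card_curves_through_two_points_le hl hl1 f2 (hEmem _ f1).2.2.2 _ ?_ ?_
      · intro b hb
        obtain ⟨t, ht, rfl⟩ := Finset.mem_image.1 hb
        obtain ⟨h0, h1, h2, h3, h4⟩ := hFmem t ht
        have := (hEmem _ (hTmem t h0).1).2.2.1
        rw [← h1, ← h3]
        exact this
      · intro b hb
        obtain ⟨t, ht, rfl⟩ := Finset.mem_image.1 hb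
        obtain ⟨h0, h1, h2, h3, h4⟩ := hFmem t ht
        obtain ⟨-, k0, k1, k2, -⟩ := hTmem t h0
        have := (hEmem _ k0).2.2.1
        rw [← h2, ← h4]
        simp only [k1, k2]
        exact this
  have hsplit := Finset.card_filter_add_card_filter_not (s := N) (fun e => e.1.1 = e.2.1)
  rw [Finset.card_product] at hTcard
  have hVV : V.card * V.card ≤ (A.card * s) ^ 2 := by
    rw [sq]; exact Nat.mul_le_mul hVcard hVcard
  simp only [Finset.card_product, Finset.card_range] at hcard
  rw [← sq] at hcard
  rw [← hE] at hsplit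
  omega

theorem card_sq_le_card_image_cosineForm_mul {l : ℝ} (hl : l ≠ 0) (hl1 : l ^ 2 ≠ 1)
    (A B : Finset ℝ) {s : ℕ} (hs : 0 < s) :
    (A.card * B.card) ^ 2 ≤ 4 * (((A ×ˢ B).image (cosineForm l)).card *
      (2 * (A.card * B.card) + B.card ^ 2 * (2 * (A.card / s) + 1) + 2 * (A.card * s) ^ 2)) := by
  obtain ⟨σ, hσ, G, hGAB, hG, hcard⟩ : ∃ σ : ℝ, σ ≠ 0 ∧ ∃ G ⊆ A ×ˢ B,
      (∀ p ∈ G, 0 ≤ σ * (p.1 - l * p.2)) ∧ A.card * B.card ≤ 2 * G.card := by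
    have hsplit := Finset.card_filter_add_card_filter_not (s := A ×ˢ B)
      (fun p => 0 ≤ p.1 - l * p.2)
    rw [Finset.card_product] at hsplit
    rcases le_total ((A ×ˢ B).filter (fun p => 0 ≤ p.1 - l * p.2)).card
      ((A ×ˢ B).filter (fun p => ¬ 0 ≤ p.1 - l * p.2)).card with h | h
    · refine ⟨-1, by norm_num, _,
        Finset.filter_subset (fun p => ¬ 0 ≤ p.1 - l * p.2) _, ?_, by omega⟩
      intro p hp
      have := (Finset.mem_filter.1 hp).2
      linarith
    · refine ⟨1, one_ne_zero, _,
        Finset.filter_subset (fun p => 0 ≤ p.1 - l * p.2) _, ?_, by omega⟩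
      intro p hp
      have := (Finset.mem_filter.1 hp).2
      linarith
  have h1 := card_sq_le_card_image_mul_card_fiber_pairs G (cosineForm l)
  have h2 := energy_cosineForm_le hl hl1 hσ A B G hGAB hG hs
  have h3 : (G.image (cosineForm l)).card ≤ ((A ×ˢ B).image (cosineForm l)).card :=
    Finset.card_le_card (Finset.image_subset_image hGAB)
  calc (A.card * B.card) ^ 2 ≤ (2 * G.card) ^ 2 := Nat.pow_le_pow_left hcard 2
    _ = 4 * G.card ^ 2 := by ring
    _ ≤ _ := Nat.mul_le_mul_left 4 (h1.trans (Nat.mul_le_mul h3 h2))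

/-- The values of `cosineForm` on `A × B` number at least a constant times `(|A||B|)^{2/3}`,
as long as `|A| ≤ |B| ≤ |A|²`. -/
theorem card_image_cosineForm_ge {l : ℝ} (hl : l ≠ 0) (hl1 : l ^ 2 ≠ 1) (A B : Finset ℝ)
    (hB : 0 < B.card) (hAB : A.card ≤ B.card) (hBA : B.card ≤ A.card ^ 2) :
    ∃ y : ℝ, 0 ≤ y ∧ y ^ 3 = ((A.card : ℝ) * B.card) ^ 2 ∧
      y / 52 ≤ ((A ×ˢ B).image (cosineForm l)).card := by
  have hA : 0 < A.card := by
    rcases Nat.eq_zero_or_pos A.card with h | h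
    · rw [h] at hBA; omega
    · exact h
  have hmain := fun s : ℕ => fun hs : 0 < s => card_sq_le_card_image_cosineForm_mul hl hl1 A B hs
  generalize ((A ×ˢ B).image (cosineForm l)).card = d at *
  generalize A.card = n at *
  generalize B.card = m at *
  have hn1 : (1 : ℝ) ≤ n := by exact_mod_cast hA
  have hnm : (n : ℝ) ≤ m := by exact_mod_cast hAB
  have hmn : (m : ℝ) ≤ (n : ℝ) ^ 2 := by exact_mod_cast hBA
  have hn0 : (0 : ℝ) < n := by linarith
  set x : ℝ := ((m : ℝ) ^ 2 / n) ^ ((1 : ℝ) / 3) with hx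
  have hx3 : x ^ 3 * n = (m : ℝ) ^ 2 := by
    rw [hx, ← Real.rpow_natCast, ← Real.rpow_mul (by positivity)]
    norm_num
    field_simp
  have hx0 : 0 ≤ x := by positivity
  have hx1 : 1 ≤ x := by
    apply Real.one_le_rpow _ (by norm_num)
    rw [le_div_iff₀ hn0]
    nlinarith
  have hxn : x ≤ n := by
    apply le_of_pow_le_pow_left₀ (n := 3) (by norm_num) hn0.le
    apply le_of_mul_le_mul_right _ hn0
    rw [hx3]
    calc (m : ℝ) ^ 2 ≤ ((n : ℝ) ^ 2) ^ 2 := by gcongr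
      _ = _ := by ring
  set s := ⌈x⌉₊ with hs
  have hs0 : 0 < s := Nat.ceil_pos.2 (by linarith)
  have hsx : x ≤ s := Nat.le_ceil x
  have hs2 : (s : ℝ) ≤ 2 * x := by
    have := Nat.ceil_lt_add_one hx0
    linarith
  have hsn : s ≤ n := Nat.ceil_le.2 hxn
  have hdiv : (2 * ((n / s : ℕ) : ℝ) + 1) * x ≤ 3 * n := by
    have h1 : ((n / s : ℕ) : ℝ) * s ≤ n := by exact_mod_cast Nat.div_mul_le_self n s
    have h2 : ((n / s : ℕ) : ℝ) * x ≤ ((n / s : ℕ) : ℝ) * s := by gcongr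
    linarith
  have hmain' : ((n : ℝ) * m) ^ 2 ≤ 4 * (d * (2 * (n * m) + m ^ 2 * (2 * ((n / s : ℕ) : ℝ) + 1)
      + 2 * (n * s) ^ 2)) := by exact_mod_cast hmain s hs0
  have hy3 : (n * x) ^ 3 = ((n : ℝ) * m) ^ 2 := by
    linear_combination (n : ℝ) ^ 2 * hx3
  have hy1 : 1 ≤ n * x := one_le_mul_of_one_le_of_one_le hn1 hx1
  refine ⟨n * x, by positivity, hy3, ?_⟩
  have t1 : (n : ℝ) * m ≤ (n * x) ^ 2 := by
    apply le_of_pow_le_pow_left₀ (n := 2) (by norm_num) (by positivity)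
    rw [← hy3, ← pow_mul]
    exact pow_le_pow_right₀ hy1 (by norm_num)
  have t2 : (m : ℝ) ^ 2 * (2 * ((n / s : ℕ) : ℝ) + 1) ≤ 3 * (n * x) ^ 2 := by
    calc (m : ℝ) ^ 2 * (2 * ((n / s : ℕ) : ℝ) + 1)
        = x ^ 2 * n * ((2 * ((n / s : ℕ) : ℝ) + 1) * x) := by rw [← hx3]; ring
      _ ≤ x ^ 2 * n * (3 * n) := by gcongr
      _ = _ := by ring
  have t3 : ((n : ℝ) * s) ^ 2 ≤ 4 * (n * x) ^ 2 := by
    calc ((n : ℝ) * s) ^ 2 ≤ (n * (2 * x)) ^ 2 := by gcongr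
      _ = _ := by ring
  have hfin : (n * x) ^ 3 ≤ 4 * (d * (13 * (n * x) ^ 2)) := by
    rw [hy3]
    refine hmain'.trans ?_
    gcongr
    linarith
  have hsq : 0 < (n * x) ^ 2 := by positivity
  rw [div_le_iff₀ (by norm_num)]
  apply le_of_mul_le_mul_right _ hsq
  linarith

/-- Two sets on two nonparallel, nonorthogonal lines of the plane can be parametrized so that
squared distances are given by `cosineForm`. -/
theorem exists_cosineForm_coordinates (P₁ P₂ : Finset (EuclideanSpace ℝ (Fin 2)))
    (o₁ v₁ o₂ v₂ : EuclideanSpace ℝ (Fin 2)) (hv₁ : v₁ ≠ 0) (hv₂ : v₂ ≠ 0)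
    (h₁ : ∀ p ∈ P₁, ∃ t : ℝ, p = o₁ + t • v₁) (h₂ : ∀ p ∈ P₂, ∃ t : ℝ, p = o₂ + t • v₂)
    (hpar : ¬ ∃ r : ℝ, v₂ = r • v₁) (horth : ⟪v₁, v₂⟫ ≠ (0 : ℝ)) :
    ∃ (l : ℝ) (f g : EuclideanSpace ℝ (Fin 2) → ℝ), l ≠ 0 ∧ l ^ 2 ≠ 1 ∧
      Set.InjOn f P₁ ∧ Set.InjOn g P₂ ∧
      ∀ p ∈ P₁, ∀ q ∈ P₂, cosineForm l (f p, g q) = dist p q ^ 2 := by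
  have hdet : v₁ 0 * v₂ 1 - v₁ 1 * v₂ 0 ≠ 0 := by
    intro h
    apply hpar
    by_cases h0 : v₁ 0 = 0
    · have h1 : v₁ 1 ≠ 0 := by
        intro h1
        apply hv₁
        ext i
        fin_cases i <;> simp [h0, h1]
      refine ⟨v₂ 1 / v₁ 1, ?_⟩
      ext i
      fin_cases i
      · have : v₂ 0 = 0 := by
          rw [h0] at h
          have : v₁ 1 * v₂ 0 = 0 := by linarith
          exact (mul_eq_zero.1 this).resolve_left h1
        simp [h0, this]
      · simp [h1]
    · refine ⟨v₂ 0 / v₁ 0, ?_⟩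
      ext i
      fin_cases i
      · simp [h0]
      · simp
        field_simp
        linarith
  have hn₁ : 0 < ‖v₁‖ := norm_pos_iff.2 hv₁
  have hn₂ : 0 < ‖v₂‖ := norm_pos_iff.2 hv₂
  have sq₁ : ‖v₁‖ ^ 2 = v₁ 0 ^ 2 + v₁ 1 ^ 2 := by
    simp [EuclideanSpace.norm_sq_eq, Fin.sum_univ_two]
  have sq₂ : ‖v₂‖ ^ 2 = v₂ 0 ^ 2 + v₂ 1 ^ 2 := by
    simp [EuclideanSpace.norm_sq_eq, Fin.sum_univ_two]
  have hinner : ⟪v₁, v₂⟫ = v₁ 0 * v₂ 0 + v₁ 1 * v₂ 1 := by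
    simp [PiLp.inner_apply, Fin.sum_univ_two, mul_comm]
  obtain ⟨α, β, hαβ⟩ : ∃ α β : ℝ, o₁ + α • v₁ = o₂ + β • v₂ := by
    obtain ⟨e, he⟩ : ∃ e : ℝ, e * (v₁ 0 * v₂ 1 - v₁ 1 * v₂ 0) = 1 :=
      ⟨_, inv_mul_cancel₀ hdet⟩
    refine ⟨((o₂ 0 - o₁ 0) * v₂ 1 - (o₂ 1 - o₁ 1) * v₂ 0) * e,
      ((o₂ 0 - o₁ 0) * v₁ 1 - (o₂ 1 - o₁ 1) * v₁ 0) * e, ?_⟩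
    ext i
    fin_cases i
    · simp only [PiLp.add_apply, PiLp.smul_apply, smul_eq_mul, Fin.zero_eta]
      linear_combination (o₂ 0 - o₁ 0) * he
    · simp only [PiLp.add_apply, PiLp.smul_apply, smul_eq_mul, Fin.mk_one]
      linear_combination (o₂ 1 - o₁ 1) * he
  choose! t ht using h₁
  choose! u hu using h₂
  refine ⟨⟪v₁, v₂⟫ / (‖v₁‖ * ‖v₂‖), fun p => (t p - α) * ‖v₁‖, fun q => (u q - β) * ‖v₂‖,
    by positivity, ?_, ?_, ?_, ?_⟩
  · rw [div_pow, mul_pow, sq₁, sq₂, hinner, Ne, div_eq_one_iff_eq]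
    · intro h
      apply hdet
      apply pow_eq_zero_iff two_ne_zero |>.1
      linear_combination -h
    · rw [← sq₁, ← sq₂]
      positivity
  · intro p hp q hq h
    have : t p = t q := by
      have := mul_right_cancel₀ hn₁.ne' h
      linarith
    rw [ht p hp, ht q hq, this]
  · intro p hp q hq h
    have : u p = u q := by
      have := mul_right_cancel₀ hn₂.ne' h
      linarith
    rw [hu p hp, hu q hq, this]
  · intro p hp q hq
    have hdiff : p - q = (t p - α) • v₁ - (u q - β) • v₂ := by
      have e : o₁ - o₂ = β • v₂ - α • v₁ := by
        rw [sub_eq_sub_iff_add_eq_add, hαβ, add_comm]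
      calc p - q = (o₁ + t p • v₁) - (o₂ + u q • v₂) := by rw [← ht p hp, ← hu q hq]
        _ = (o₁ - o₂) + t p • v₁ - u q • v₂ := by abel
        _ = _ := by rw [e]; module
    rw [dist_eq_norm, hdiff, norm_sub_sq_real, norm_smul, norm_smul, inner_smul_left,
      inner_smul_right, mul_pow, mul_pow, Real.norm_eq_abs, Real.norm_eq_abs, sq_abs, sq_abs]
    simp only [cosineForm, conj_trivial]
    field_simp
    ring

/-- The unbalanced case: if `|P₁| = ⌈m^{1/2+ε}⌉` and `|P₂| = m`, with the two point sets on
lines that are neither parallel nor orthogonal, then `D(P₁,P₂) = Ω(m^{1+2ε/3})`. -/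
theorem distinct_distances_two_lines_unbalanced (ε : ℝ) (hε : 0 < ε) (hε' : ε ≤ 1/2) :
    ∃ c : ℝ, 0 < c ∧
      ∀ (P₁ P₂ : Finset (EuclideanSpace ℝ (Fin 2)))
        (o₁ v₁ o₂ v₂ : EuclideanSpace ℝ (Fin 2)) (m : ℕ),
        P₁.card = ⌈(m : ℝ) ^ (1/2 + ε)⌉₊ → P₂.card = m →
        v₁ ≠ 0 → v₂ ≠ 0 →
        (∀ p ∈ P₁, ∃ t : ℝ, p = o₁ + t • v₁) →
        (∀ p ∈ P₂, ∃ t : ℝ, p = o₂ + t • v₂) →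
        (¬ ∃ r : ℝ, v₂ = r • v₁) →
        ⟪v₁, v₂⟫ ≠ (0 : ℝ) →
        c * (m : ℝ) ^ (1 + 2*ε/3)
          ≤ ((P₁ ×ˢ P₂).image (fun pq => dist pq.1 pq.2)).card := by
  refine ⟨1 / 52, by norm_num, ?_⟩
  intro P₁ P₂ o₁ v₁ o₂ v₂ m hP₁ hP₂ hv₁ hv₂ h₁ h₂ hpar horth
  rcases Nat.eq_zero_or_pos m with rfl | hm
  · rw [Nat.cast_zero, Real.zero_rpow (by positivity), mul_zero]
    positivity
  obtain ⟨l, f, g, hl, hl1, hf, hg, hfg⟩ :=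
    exists_cosineForm_coordinates P₁ P₂ o₁ v₁ o₂ v₂ hv₁ hv₂ h₁ h₂ hpar horth
  have hm1 : (1 : ℝ) ≤ m := by exact_mod_cast hm
  have hA : (P₁.image f).card = ⌈(m : ℝ) ^ (1/2 + ε)⌉₊ := by
    rw [Finset.card_image_of_injOn hf, hP₁]
  have hB : (P₂.image g).card = m := by rw [Finset.card_image_of_injOn hg, hP₂]
  have hle : (m : ℝ) ^ (1/2 + ε) ≤ ((P₁.image f).card : ℝ) := by
    rw [hA]; exact Nat.le_ceil _
  have hAB : (P₁.image f).card ≤ (P₂.image g).card := by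
    rw [hA, hB]
    refine Nat.ceil_le.2 ?_
    calc (m : ℝ) ^ (1/2 + ε) ≤ (m : ℝ) ^ (1 : ℝ) :=
          Real.rpow_le_rpow_of_exponent_le hm1 (by linarith)
      _ = m := Real.rpow_one _
  have hBA : (P₂.image g).card ≤ (P₁.image f).card ^ 2 := by
    rw [hB]
    have : (m : ℝ) ≤ ((P₁.image f).card : ℝ) ^ 2 := by
      calc (m : ℝ) = (m : ℝ) ^ (1 : ℝ) := (Real.rpow_one _).symm
        _ ≤ (m : ℝ) ^ ((1/2 + ε) * (2 : ℕ)) :=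
          Real.rpow_le_rpow_of_exponent_le hm1 (by push_cast; linarith)
        _ = ((m : ℝ) ^ (1/2 + ε)) ^ 2 := by
          rw [Real.rpow_mul (by positivity), Real.rpow_natCast]
        _ ≤ _ := by gcongr
    exact_mod_cast this
  obtain ⟨y, hy0, hy3, hy⟩ := card_image_cosineForm_ge hl hl1 (P₁.image f) (P₂.image g)
    (by rw [hB]; exact hm) hAB hBA
  have hmy : (m : ℝ) ^ (1 + 2*ε/3) ≤ y := by
    apply le_of_pow_le_pow_left₀ (n := 3) (by norm_num) hy0
    rw [hy3, hB]
    calc ((m : ℝ) ^ (1 + 2*ε/3)) ^ 3 = (m : ℝ) ^ ((1/2 + ε) * (2 : ℕ) + (2 : ℕ)) := by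
          rw [← Real.rpow_natCast, ← Real.rpow_mul (by positivity)]
          congr 1
          push_cast
          ring
      _ = ((m : ℝ) ^ (1/2 + ε) * m) ^ 2 := by
          rw [Real.rpow_add (by positivity), Real.rpow_mul (by positivity), Real.rpow_natCast,
            Real.rpow_natCast, mul_pow]
      _ ≤ _ := by gcongr
  have hcard : ((P₁.image f ×ˢ P₂.image g).image (cosineForm l)).card
      ≤ ((P₁ ×ˢ P₂).image (fun pq => dist pq.1 pq.2)).card := by
    refine (Finset.card_le_card ?_).trans (Finset.card_image_le (f := fun r : ℝ => r ^ 2))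
    intro z hz
    obtain ⟨⟨a, b⟩, hab, rfl⟩ := Finset.mem_image.1 hz
    obtain ⟨ha, hb⟩ := Finset.mem_product.1 hab
    obtain ⟨p, hp, rfl⟩ := Finset.mem_image.1 ha
    obtain ⟨q, hq, rfl⟩ := Finset.mem_image.1 hb
    exact Finset.mem_image.2 ⟨dist p q,
      Finset.mem_image.2 ⟨(p, q), Finset.mem_product.2 ⟨hp, hq⟩, rfl⟩, (hfg p hp q hq).symm⟩
  have hcard' : (((P₁.image f ×ˢ P₂.image g).image (cosineForm l)).card : ℝ)
      ≤ ((P₁ ×ˢ P₂).image (fun pq => dist pq.1 pq.2)).card := by exact_mod_cast hcard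
  linarith
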